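/- Let n ≥ 1, let g : ℝⁿ → (symmetric positive-definite n×n real matrices) be smooth, let φ : ℝ → ℝ be smooth and positive, and let γ : ℝ × [0,t₀) → ℝ^{1+n} be a curve shortening flow in local coordinates with respect to the right warped product metric G_R. If at a point (x,t) the angle function Θ_R = ⟨T, ∂r⟩_{G_R} satisfies 0 ≤ Θ_R ≤ 1, then at that point ∂_t Θ_R ≥ ΔΘ_R − |(log φ)''(γ⁰)| Θ_R + 2 (log φ)'(γ⁰) Θ_R T(Θ_R), where γ⁰ denotes the 0-th component of γ(x,t). -/

import Mathlib

open scoped BigOperators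

noncomputable section

/-- Inner product of two vectors with respect to a metric matrix `G`. -/
def minner {m : ℕ} (G : Matrix (Fin m) (Fin m) ℝ) (u v : Fin m → ℝ) : ℝ :=
  ∑ α, ∑ β, u α * G α β * v β

/-- Norm of a vector with respect to a metric matrix `G`. -/
def mnorm {m : ℕ} (G : Matrix (Fin m) (Fin m) ℝ) (v : Fin m → ℝ) : ℝ :=
  Real.sqrt (minner G v v)

/-- Christoffel symbols `Γ^α_{βγ}` of the metric `G` at the point `p`:
`Γ^α_{βγ} = (1/2) Σ_δ (G⁻¹)^{αδ}(∂_β G_{δγ} + ∂_γ G_{δβ} − ∂_δ G_{βγ})`. -/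
def christoffel {m : ℕ} (G : (Fin m → ℝ) → Matrix (Fin m) (Fin m) ℝ)
    (p : Fin m → ℝ) (α β γ : Fin m) : ℝ :=
  (1 / 2) * ∑ δ, (G p)⁻¹ α δ *
      (fderiv ℝ (fun q => G q δ γ) p (Pi.single β 1)
        + fderiv ℝ (fun q => G q δ β) p (Pi.single γ 1)
        - fderiv ℝ (fun q => G q β γ) p (Pi.single δ 1))

/-- Unit tangent vector `T = ∂ₓc/|∂ₓc|_G` of a curve `c` with respect to the metric `G`. -/
def unitT {m : ℕ} (G : (Fin m → ℝ) → Matrix (Fin m) (Fin m) ℝ)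
    (c : ℝ → Fin m → ℝ) (x : ℝ) : Fin m → ℝ :=
  (mnorm (G (c x)) (deriv c x))⁻¹ • deriv c x

/-- Covariant derivative `∇_T V` of a vector field `V` along the curve `c`. -/
def covT {m : ℕ} (G : (Fin m → ℝ) → Matrix (Fin m) (Fin m) ℝ)
    (c V : ℝ → Fin m → ℝ) (x : ℝ) : Fin m → ℝ :=
  fun α => (mnorm (G (c x)) (deriv c x))⁻¹ *
    (deriv (fun y => V y α) x
      + ∑ β, ∑ δ, christoffel G (c x) α β δ * deriv c x β * V x δ)

/-- Mean curvature vector `H = ∇_T T` of the curve `c`. -/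
def meanCurv {m : ℕ} (G : (Fin m → ℝ) → Matrix (Fin m) (Fin m) ℝ)
    (c : ℝ → Fin m → ℝ) : ℝ → Fin m → ℝ :=
  covT G c (unitT G c)

/-- Directional derivative `T(η) = |∂ₓc|⁻¹ ∂ₓη` of a scalar function along the curve `c`. -/
def Tscal {m : ℕ} (G : (Fin m → ℝ) → Matrix (Fin m) (Fin m) ℝ)
    (c : ℝ → Fin m → ℝ) (η : ℝ → ℝ) (x : ℝ) : ℝ :=
  (mnorm (G (c x)) (deriv c x))⁻¹ * deriv η x

/-- Laplacian `Δη = T(T(η))` along the curve `c`. -/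
def lapScal {m : ℕ} (G : (Fin m → ℝ) → Matrix (Fin m) (Fin m) ℝ)
    (c : ℝ → Fin m → ℝ) (η : ℝ → ℝ) : ℝ → ℝ :=
  Tscal G c (Tscal G c η)

/-- Time covariant derivative `∇_t V` along a flow `γ`. -/
def covTime {m : ℕ} (G : (Fin m → ℝ) → Matrix (Fin m) (Fin m) ℝ)
    (γ V : ℝ → ℝ → Fin m → ℝ) (x t : ℝ) : Fin m → ℝ :=
  fun α => deriv (fun s => V x s α) t
    + ∑ β, ∑ δ, christoffel G (γ x t) α β δ * deriv (fun s => γ x s β) t * V x t δ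

/-- Left warped product metric `g + ψ²(x) dr²` on `ℝ^{1+n}` (index 0 is the circle direction). -/
def gwL {n : ℕ} (g : (Fin n → ℝ) → Matrix (Fin n) (Fin n) ℝ)
    (ψ : (Fin n → ℝ) → ℝ) (p : Fin (n + 1) → ℝ) : Matrix (Fin (n + 1)) (Fin (n + 1)) ℝ :=
  Matrix.of fun α β =>
    Fin.cases (Fin.cases ((ψ fun i => p i.succ) ^ 2) (fun _ => 0) β)
      (fun i => Fin.cases 0 (fun j => g (fun k => p k.succ) i j) β) α

/-- Right warped product metric `φ²(r) g + dr²` on `ℝ^{1+n}` (index 0 is the circle direction). -/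
def gwR {n : ℕ} (g : (Fin n → ℝ) → Matrix (Fin n) (Fin n) ℝ)
    (φ : ℝ → ℝ) (p : Fin (n + 1) → ℝ) : Matrix (Fin (n + 1)) (Fin (n + 1)) ℝ :=
  Matrix.of fun α β =>
    Fin.cases (Fin.cases 1 (fun _ => 0) β)
      (fun i => Fin.cases 0 (fun j => (φ (p 0)) ^ 2 * g (fun k => p k.succ) i j) β) α

/-- The vector `∂r = e₀` in `ℝ^{1+n}`. -/
def er (n : ℕ) : Fin (n + 1) → ℝ := Pi.single 0 1

/-- The gradient `D(log ψ)` of `log ψ` with respect to `(N, g)`, as a vector in `ℝ^{1+n}`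
with vanishing 0-th component. -/
def DlogPsi {n : ℕ} (g : (Fin n → ℝ) → Matrix (Fin n) (Fin n) ℝ)
    (ψ : (Fin n → ℝ) → ℝ) (x : Fin n → ℝ) : Fin (n + 1) → ℝ :=
  Fin.cases 0 (fun i => ∑ k, (g x)⁻¹ i k *
    fderiv ℝ (fun y => Real.log (ψ y)) x (Pi.single k 1))

/-- `|D(log ψ)|² = Σ_{k,l} (g⁻¹)^{kl} ∂_k(log ψ) ∂_l(log ψ)`. -/
def normSqDlogPsi {n : ℕ} (g : (Fin n → ℝ) → Matrix (Fin n) (Fin n) ℝ)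
    (ψ : (Fin n → ℝ) → ℝ) (x : Fin n → ℝ) : ℝ :=
  ∑ k, ∑ l, (g x)⁻¹ k l *
    fderiv ℝ (fun y => Real.log (ψ y)) x (Pi.single k 1) *
    fderiv ℝ (fun y => Real.log (ψ y)) x (Pi.single l 1)

/-- `∇_X ∂r` at the point `p`, i.e. `(∇_X ∂r)^α = Σ_β X^β Γ^α_{β0}`. -/
def covR {m : ℕ} [NeZero m] (G : (Fin m → ℝ) → Matrix (Fin m) (Fin m) ℝ)
    (p : Fin m → ℝ) (X : Fin m → ℝ) : Fin m → ℝ :=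
  fun α => ∑ β, X β * christoffel G p α β 0

/-- The angle function `Θ_L = ⟨T, ∂r⟩_{G_L}` of a flow `γ` in the left warped product. -/
def thetaL {n : ℕ} (g : (Fin n → ℝ) → Matrix (Fin n) (Fin n) ℝ)
    (ψ : (Fin n → ℝ) → ℝ) (γ : ℝ → ℝ → Fin (n + 1) → ℝ) (x t : ℝ) : ℝ :=
  minner (gwL g ψ (γ x t)) (unitT (gwL g ψ) (fun y => γ y t) x) (er n)

/-- The angle function `Θ_R = ⟨T, ∂r⟩_{G_R}` of a flow `γ` in the right warped product. -/
def thetaR {n : ℕ} (g : (Fin n → ℝ) → Matrix (Fin n) (Fin n) ℝ)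
    (φ : ℝ → ℝ) (γ : ℝ → ℝ → Fin (n + 1) → ℝ) (x t : ℝ) : ℝ :=
  minner (gwR g φ (γ x t)) (unitT (gwR g φ) (fun y => γ y t) x) (er n)

/-- The contraction `Γ(u, v)^α = Σ_{β,δ} Γ^α_{βδ} u^β v^δ` of the Christoffel symbols. -/
def christoffelForm {m : ℕ} (G : (Fin m → ℝ) → Matrix (Fin m) (Fin m) ℝ)
    (p u v : Fin m → ℝ) : Fin m → ℝ :=
  fun α => ∑ β, ∑ δ, christoffel G p α β δ * u β * v δ

theorem minner_comm {m : ℕ} {A : Matrix (Fin m) (Fin m) ℝ} (hA : ∀ i j, A i j = A j i)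
    (u v : Fin m → ℝ) : minner A u v = minner A v u := by
  unfold minner
  rw [Finset.sum_comm]
  refine Finset.sum_congr rfl fun α _ => Finset.sum_congr rfl fun β _ => ?_
  rw [hA β α]; ring

theorem minner_add_left {m : ℕ} (A : Matrix (Fin m) (Fin m) ℝ) (u v w : Fin m → ℝ) :
    minner A (u + v) w = minner A u w + minner A v w := by
  simp only [minner, ← Finset.sum_add_distrib, Pi.add_apply]
  refine Finset.sum_congr rfl fun α _ => Finset.sum_congr rfl fun β _ => by ring

theorem minner_smul_left {m : ℕ} (A : Matrix (Fin m) (Fin m) ℝ) (a : ℝ) (u v : Fin m → ℝ) :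
    minner A (a • u) v = a * minner A u v := by
  simp only [minner, Finset.mul_sum, Pi.smul_apply, smul_eq_mul]
  refine Finset.sum_congr rfl fun α _ => Finset.sum_congr rfl fun β _ => by ring

theorem minner_smul_right {m : ℕ} (A : Matrix (Fin m) (Fin m) ℝ) (a : ℝ) (u v : Fin m → ℝ) :
    minner A u (a • v) = a * minner A u v := by
  simp only [minner, Finset.mul_sum, Pi.smul_apply, smul_eq_mul]
  refine Finset.sum_congr rfl fun α _ => Finset.sum_congr rfl fun β _ => by ring

theorem minner_eq_dotProduct {m : ℕ} (A : Matrix (Fin m) (Fin m) ℝ) (u v : Fin m → ℝ) :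
    minner A u v = u ⬝ᵥ A.mulVec v := by
  simp only [minner, dotProduct, Matrix.mulVec, Finset.mul_sum, mul_assoc]

theorem minner_self_pos {m : ℕ} {A : Matrix (Fin m) (Fin m) ℝ} (hA : A.PosDef)
    {v : Fin m → ℝ} (hv : v ≠ 0) : 0 < minner A v v := by
  rw [minner_eq_dotProduct]
  simpa using hA.dotProduct_mulVec_pos hv

theorem minner_self_nonneg {m : ℕ} {A : Matrix (Fin m) (Fin m) ℝ} (hA : A.PosDef)
    (v : Fin m → ℝ) : 0 ≤ minner A v v := by
  rw [minner_eq_dotProduct]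
  simpa using hA.posSemidef.dotProduct_mulVec_nonneg v

section Metric

variable {m : ℕ} {G : (Fin m → ℝ) → Matrix (Fin m) (Fin m) ℝ}

theorem christoffel_symm (hsymm : ∀ p i j, G p i j = G p j i) (p : Fin m → ℝ) (α β δ : Fin m) :
    christoffel G p α β δ = christoffel G p α δ β := by
  unfold christoffel
  have h : (fun q => G q β δ) = fun q => G q δ β := funext fun q => hsymm q β δ
  simp only [h]
  congr 1
  refine Finset.sum_congr rfl fun μ _ => by ring

theorem christoffelForm_comm (hsymm : ∀ p i j, G p i j = G p j i) (p u v : Fin m → ℝ) :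
    christoffelForm G p u v = christoffelForm G p v u := by
  funext α
  unfold christoffelForm
  rw [Finset.sum_comm]
  refine Finset.sum_congr rfl fun β _ => Finset.sum_congr rfl fun δ _ => ?_
  rw [christoffel_symm hsymm p α δ β]; ring

theorem lower_christoffel {p : Fin m → ℝ} (hsymm : ∀ p i j, G p i j = G p j i)
    (hG : (G p).PosDef) (μ β δ : Fin m) :
    ∑ α, christoffel G p α β δ * G p α μ =
      (1 / 2) * (fderiv ℝ (fun q => G q μ δ) p (Pi.single β 1)
        + fderiv ℝ (fun q => G q μ β) p (Pi.single δ 1)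
        - fderiv ℝ (fun q => G q β δ) p (Pi.single μ 1)) := by
  have hinv : G p * (G p)⁻¹ = 1 :=
    Matrix.mul_nonsing_inv _ ((Matrix.isUnit_iff_isUnit_det _).1 hG.isUnit)
  have hentry : ∀ ν, ∑ α, G p μ α * (G p)⁻¹ α ν = if μ = ν then 1 else 0 := by
    intro ν
    rw [← Matrix.mul_apply, hinv, Matrix.one_apply]
  simp only [christoffel, Finset.mul_sum, Finset.sum_mul]
  rw [Finset.sum_comm]
  rw [Finset.sum_eq_single μ]
  · have := hentry μ
    simp only [if_true] at this
    rw [← one_mul (1 / 2 * _), ← this, Finset.sum_mul]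
    refine Finset.sum_congr rfl fun α _ => ?_
    rw [hsymm p α μ]; ring
  · intro ν _ hν
    have := hentry ν
    rw [if_neg hν.symm] at this
    rw [← zero_mul (1 / 2 * (fderiv ℝ (fun q => G q ν δ) p (Pi.single β 1)
        + fderiv ℝ (fun q => G q ν β) p (Pi.single δ 1)
        - fderiv ℝ (fun q => G q β δ) p (Pi.single ν 1))), ← this, Finset.sum_mul]
    refine Finset.sum_congr rfl fun α _ => ?_
    rw [hsymm p α μ]; ring
  · simp

theorem minner_christoffelForm {p : Fin m → ℝ} (hsymm : ∀ p i j, G p i j = G p j i)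
    (hG : (G p).PosDef) (u V W : Fin m → ℝ) :
    minner (G p) (christoffelForm G p u V) W =
      ∑ δ, ∑ μ, ∑ β, (1 / 2) * (fderiv ℝ (fun q => G q μ δ) p (Pi.single β 1)
        + fderiv ℝ (fun q => G q μ β) p (Pi.single δ 1)
        - fderiv ℝ (fun q => G q β δ) p (Pi.single μ 1)) * u β * V δ * W μ := by
  simp only [← lower_christoffel hsymm hG, minner, christoffelForm, Finset.sum_mul]
  have h1 : ∀ α, ∑ μ, ∑ β, ∑ δ, christoffel G p α β δ * u β * V δ * G p α μ * W μ
      = ∑ δ, ∑ μ, ∑ β, christoffel G p α β δ * G p α μ * u β * V δ * W μ := by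
    intro α
    have : ∀ μ, ∑ β, ∑ δ, christoffel G p α β δ * u β * V δ * G p α μ * W μ
        = ∑ δ, ∑ β, christoffel G p α β δ * G p α μ * u β * V δ * W μ := by
      intro μ
      rw [Finset.sum_comm]
      refine Finset.sum_congr rfl fun _ _ => Finset.sum_congr rfl fun _ _ => by ring
    simp only [this]
    rw [Finset.sum_comm]
  simp only [h1]
  rw [Finset.sum_comm]
  refine Finset.sum_congr rfl fun δ _ => ?_
  rw [Finset.sum_comm]
  refine Finset.sum_congr rfl fun μ _ => ?_
  rw [Finset.sum_comm]

theorem fderiv_eq_sum_single (f : (Fin m → ℝ) → ℝ) (p u : Fin m → ℝ) :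
    fderiv ℝ f p u = ∑ β, u β * fderiv ℝ f p (Pi.single β 1) := by
  conv_lhs => rw [pi_eq_sum_univ' u]
  simp [map_sum, map_smul]

/-- The Levi-Civita connection is compatible with the metric. -/
theorem minner_christoffelForm_add {p : Fin m → ℝ} (hsymm : ∀ p i j, G p i j = G p j i)
    (hG : (G p).PosDef) (u V W : Fin m → ℝ) :
    minner (G p) (christoffelForm G p u V) W + minner (G p) V (christoffelForm G p u W) =
      ∑ δ, ∑ μ, V δ * fderiv ℝ (fun q => G q δ μ) p u * W μ := by
  rw [minner_comm (hsymm p) V, minner_christoffelForm hsymm hG, minner_christoffelForm hsymm hG]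
  nth_rewrite 2 [Finset.sum_comm]
  simp only [← Finset.sum_add_distrib]
  refine Finset.sum_congr rfl fun δ _ => Finset.sum_congr rfl fun μ _ => ?_
  rw [fderiv_eq_sum_single, Finset.mul_sum, Finset.sum_mul]
  refine Finset.sum_congr rfl fun β _ => ?_
  have h : ∀ i j, (fun q => G q i j) = fun q => G q j i := fun i j => funext fun q => hsymm q i j
  rw [h μ δ, h μ β, h δ β]
  ring

theorem hasDerivAt_minner {c V W : ℝ → Fin m → ℝ} {c' V' W' : Fin m → ℝ} {s : ℝ}
    (hsymm : ∀ p i j, G p i j = G p j i) (hG : (G (c s)).PosDef)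
    (hd : ∀ i j, DifferentiableAt ℝ (fun q => G q i j) (c s))
    (hc : HasDerivAt c c' s) (hV : HasDerivAt V V' s) (hW : HasDerivAt W W' s) :
    HasDerivAt (fun s => minner (G (c s)) (V s) (W s))
      (minner (G (c s)) (V' + christoffelForm G (c s) c' (V s)) (W s)
        + minner (G (c s)) (V s) (W' + christoffelForm G (c s) c' (W s))) s := by
  have hV := hasDerivAt_pi.1 hV
  have hW := hasDerivAt_pi.1 hW
  have hGc : ∀ i j, HasDerivAt (fun s => G (c s) i j) (fderiv ℝ (fun q => G q i j) (c s) c') s :=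
    fun i j => (hd i j).hasFDerivAt.comp_hasDerivAt s hc
  have key := HasDerivAt.fun_sum (u := Finset.univ) fun α _ =>
    HasDerivAt.fun_sum (u := Finset.univ) fun β _ => ((hV α).mul (hGc α β)).mul (hW β)
  refine key.congr_deriv ?_
  rw [minner_add_left, minner_comm (hsymm _) (V s), minner_add_left,
    minner_comm (hsymm _) (christoffelForm G (c s) c' (W s)), add_add_add_comm,
    minner_christoffelForm_add hsymm hG, minner_comm (hsymm _) W' (V s)]
  simp only [minner, ← Finset.sum_add_distrib]
  refine Finset.sum_congr rfl fun δ _ => Finset.sum_congr rfl fun μ _ => ?_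
  simp only [Pi.mul_apply]
  ring

theorem mnorm_sq {p : Fin m → ℝ} (hG : (G p).PosDef) (v : Fin m → ℝ) :
    mnorm (G p) v ^ 2 = minner (G p) v v :=
  Real.sq_sqrt (minner_self_nonneg hG v)

theorem mnorm_pos {p : Fin m → ℝ} (hG : (G p).PosDef) {v : Fin m → ℝ} (hv : v ≠ 0) :
    0 < mnorm (G p) v :=
  Real.sqrt_pos.2 (minner_self_pos hG hv)

section Curve

variable {c : ℝ → Fin m → ℝ}

theorem minner_unitT_self {y : ℝ} (hG : (G (c y)).PosDef) (hreg : deriv c y ≠ 0) :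
    minner (G (c y)) (unitT G c y) (unitT G c y) = 1 := by
  have hN := mnorm_pos hG hreg
  rw [unitT, minner_smul_left, minner_smul_right, ← mnorm_sq hG]
  field_simp

theorem deriv_eq_smul_unitT {y : ℝ} (hG : (G (c y)).PosDef) (hreg : deriv c y ≠ 0) :
    deriv c y = mnorm (G (c y)) (deriv c y) • unitT G c y := by
  rw [unitT, smul_inv_smul₀ (mnorm_pos hG hreg).ne']

theorem differentiableAt_minner_comp {V W : ℝ → Fin m → ℝ} {y : ℝ}
    (hsymm : ∀ p i j, G p i j = G p j i) (hG : (G (c y)).PosDef)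
    (hd : ∀ i j, DifferentiableAt ℝ (fun q => G q i j) (c y))
    (hc : DifferentiableAt ℝ c y) (hV : DifferentiableAt ℝ V y) (hW : DifferentiableAt ℝ W y) :
    DifferentiableAt ℝ (fun s => minner (G (c s)) (V s) (W s)) y :=
  (hasDerivAt_minner hsymm hG hd hc.hasDerivAt hV.hasDerivAt hW.hasDerivAt).differentiableAt

theorem differentiableAt_unitT {y : ℝ}
    (hsymm : ∀ p i j, G p i j = G p j i) (hG : (G (c y)).PosDef)
    (hd : ∀ i j, DifferentiableAt ℝ (fun q => G q i j) (c y))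
    (hc : DifferentiableAt ℝ c y) (hc' : DifferentiableAt ℝ (deriv c) y) (hreg : deriv c y ≠ 0) :
    DifferentiableAt ℝ (unitT G c) y := by
  have h := differentiableAt_minner_comp hsymm hG hd hc hc' hc'
  have hN : DifferentiableAt ℝ (fun s => mnorm (G (c s)) (deriv c s)) y :=
    h.sqrt (minner_self_pos hG hreg).ne'
  exact (hN.inv (mnorm_pos hG hreg).ne').smul hc'

theorem smul_covT {V : ℝ → Fin m → ℝ} {y : ℝ} (hG : (G (c y)).PosDef) (hreg : deriv c y ≠ 0)
    (hV : DifferentiableAt ℝ V y) :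
    mnorm (G (c y)) (deriv c y) • covT G c V y
      = deriv V y + christoffelForm G (c y) (deriv c y) (V y) := by
  have hN := mnorm_pos hG hreg
  funext α
  have : deriv (fun z => V z α) y = deriv V y α := (hasDerivAt_pi.1 hV.hasDerivAt α).deriv
  simp only [covT, this, Pi.smul_apply, smul_eq_mul, Pi.add_apply, christoffelForm]
  field_simp

theorem minner_meanCurv_unitT (hsymm : ∀ p i j, G p i j = G p j i) (hG : ∀ p, (G p).PosDef)
    (hd : ∀ i j, Differentiable ℝ (fun q => G q i j))
    (hc : Differentiable ℝ c) (hc' : Differentiable ℝ (deriv c)) (hreg : ∀ y, deriv c y ≠ 0)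
    (y : ℝ) :
    minner (G (c y)) (meanCurv G c y) (unitT G c y) = 0 := by
  have hT := differentiableAt_unitT hsymm (hG (c y)) (fun i j => hd i j _) (hc y) (hc' y) (hreg y)
  have h := hasDerivAt_minner hsymm (hG (c y)) (fun i j => hd i j _) (hc y).hasDerivAt
    hT.hasDerivAt hT.hasDerivAt
  have h1 : (fun s => minner (G (c s)) (unitT G c s) (unitT G c s)) = fun _ => 1 :=
    funext fun s => minner_unitT_self (hG _) (hreg s)
  rw [h1] at h
  have h0 := h.unique (hasDerivAt_const y (1 : ℝ))
  rw [minner_comm (hsymm _) (unitT G c y), ← smul_covT (hG _) (hreg y) hT, minner_smul_left] at h0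
  have hN := mnorm_pos (hG (c y)) (hreg y)
  have : mnorm (G (c y)) (deriv c y) * minner (G (c y)) (covT G c (unitT G c) y) (unitT G c y) = 0 :=
    by linarith
  exact (mul_eq_zero.1 this).resolve_left hN.ne'

theorem minner_deriv_meanCurv_unitT (hsymm : ∀ p i j, G p i j = G p j i) (hG : ∀ p, (G p).PosDef)
    (hd : ∀ i j, Differentiable ℝ (fun q => G q i j))
    (hc : Differentiable ℝ c) (hc' : Differentiable ℝ (deriv c)) (hreg : ∀ y, deriv c y ≠ 0)
    {y : ℝ} (hH : DifferentiableAt ℝ (meanCurv G c) y) :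
    minner (G (c y)) (deriv (meanCurv G c) y
        + christoffelForm G (c y) (deriv c y) (meanCurv G c y)) (unitT G c y)
      = -(mnorm (G (c y)) (deriv c y) * minner (G (c y)) (meanCurv G c y) (meanCurv G c y)) := by
  have hT := differentiableAt_unitT hsymm (hG (c y)) (fun i j => hd i j _) (hc y) (hc' y) (hreg y)
  have h := hasDerivAt_minner hsymm (hG (c y)) (fun i j => hd i j _) (hc y).hasDerivAt
    hH.hasDerivAt hT.hasDerivAt
  have h1 : (fun s => minner (G (c s)) (meanCurv G c s) (unitT G c s)) = fun _ => 0 :=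
    funext fun s => minner_meanCurv_unitT hsymm hG hd hc hc' hreg s
  rw [h1] at h
  have h0 := h.unique (hasDerivAt_const y (0 : ℝ))
  rw [← smul_covT (hG _) (hreg y) hT, minner_smul_right] at h0
  have : covT G c (unitT G c) y = meanCurv G c y := rfl
  rw [this] at h0
  linarith

end Curve

section Flow

variable {γ : ℝ → ℝ → Fin m → ℝ}

theorem ContDiff.hasDerivAt_deriv_swap {E : Type*} [NormedAddCommGroup E] [NormedSpace ℝ E]
    {γ : ℝ → ℝ → E} (hγ : ContDiff ℝ (⊤ : ℕ∞) fun q : ℝ × ℝ => γ q.1 q.2) (x t : ℝ) :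
    HasDerivAt (fun s => deriv (fun y => γ y s) x) (deriv (fun y => deriv (γ y) t) x) t := by
  obtain ⟨f, hf_eq⟩ : ∃ f : ℝ × ℝ → E, f = fun q => γ q.1 q.2 := ⟨_, rfl⟩
  rw [← hf_eq] at hγ
  have hf : Differentiable ℝ f := hγ.differentiable (by simp)
  have hf' : Differentiable ℝ (fderiv ℝ f) :=
    (hγ.fderiv_right (m := (⊤ : ℕ∞)) (by simp)).differentiable (by simp)
  have hx : ∀ y s : ℝ, HasDerivAt (fun z : ℝ => (z, s)) ((1 : ℝ), (0 : ℝ)) y := fun y s =>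
    (hasDerivAt_id y).prodMk (hasDerivAt_const y s)
  have ht : ∀ y s : ℝ, HasDerivAt (fun z : ℝ => (y, z)) ((0 : ℝ), (1 : ℝ)) s := fun y s =>
    (hasDerivAt_const s y).prodMk (hasDerivAt_id s)
  have h1 : (fun s => deriv (fun y => γ y s) x) = fun s => fderiv ℝ f (x, s) (1, 0) := by
    funext s
    have h := ((hf (x, s)).hasFDerivAt.comp_hasDerivAt x (hx x s)).deriv
    rw [← h, hf_eq]; rfl
  have h2 : (fun y => deriv (γ y) t) = fun y => fderiv ℝ f (y, t) (0, 1) := by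
    funext y
    have h := ((hf (y, t)).hasFDerivAt.comp_hasDerivAt t (ht y t)).deriv
    rw [← h, hf_eq]; rfl
  have h3 : HasDerivAt (fun s => fderiv ℝ f (x, s) (1, 0))
      (fderiv ℝ (fderiv ℝ f) (x, t) (0, 1) (1, 0)) t :=
    (ContinuousLinearMap.apply ℝ E ((1 : ℝ), (0 : ℝ))).hasFDerivAt.comp_hasDerivAt t
      ((hf' (x, t)).hasFDerivAt.comp_hasDerivAt t (ht x t))
  have h4 : HasDerivAt (fun y => fderiv ℝ f (y, t) (0, 1))
      (fderiv ℝ (fderiv ℝ f) (x, t) (1, 0) (0, 1)) x :=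
    (ContinuousLinearMap.apply ℝ E ((0 : ℝ), (1 : ℝ))).hasFDerivAt.comp_hasDerivAt x
      ((hf' (x, t)).hasFDerivAt.comp_hasDerivAt x (hx x t))
  have hsym : IsSymmSndFDerivAt ℝ f (x, t) := hγ.contDiffAt.isSymmSndFDerivAt
    (by rw [minSmoothness_of_isRCLikeNormedField]; exact WithTop.coe_le_coe.2 le_top)
  rw [h1, h2, h4.deriv]
  exact h3.congr_deriv (hsym _ _)

theorem ContDiff.differentiable_deriv_left {E : Type*} [NormedAddCommGroup E] [NormedSpace ℝ E]
    {γ : ℝ → ℝ → E} (hγ : ContDiff ℝ (⊤ : ℕ∞) fun q : ℝ × ℝ => γ q.1 q.2) (t : ℝ) :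
    Differentiable ℝ (deriv fun y => γ y t) := by
  have h : ContDiff ℝ (⊤ : ℕ∞) fun y => γ y t :=
    hγ.comp (contDiff_id.prodMk contDiff_const)
  exact ((contDiff_infty_iff_deriv.1 h).2).differentiable (by simp)

theorem ContDiff.differentiable_deriv_right {E : Type*} [NormedAddCommGroup E] [NormedSpace ℝ E]
    {γ : ℝ → ℝ → E} (hγ : ContDiff ℝ (⊤ : ℕ∞) fun q : ℝ × ℝ => γ q.1 q.2) (t : ℝ) :
    Differentiable ℝ fun y => deriv (γ y) t := by
  have h : ContDiff ℝ (⊤ : ℕ∞) fun q : ℝ × ℝ => γ q.2 q.1 :=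
    hγ.comp (contDiff_snd.prodMk contDiff_fst)
  exact fun y => (h.hasDerivAt_deriv_swap t y).differentiableAt

theorem hasDerivAt_mnorm_of_flow (hsymm : ∀ p i j, G p i j = G p j i) (hG : ∀ p, (G p).PosDef)
    (hd : ∀ i j, Differentiable ℝ (fun q => G q i j))
    (hγ : ContDiff ℝ (⊤ : ℕ∞) fun q : ℝ × ℝ => γ q.1 q.2) {t : ℝ}
    (hreg : ∀ y, deriv (fun y => γ y t) y ≠ 0)
    (hflow : ∀ y, deriv (γ y) t = meanCurv G (fun y => γ y t) y) (x : ℝ) :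
    HasDerivAt (fun s => mnorm (G (γ x s)) (deriv (fun y => γ y s) x))
      (-(mnorm (G (γ x t)) (deriv (fun y => γ y t) x)
        * minner (G (γ x t)) (deriv (γ x) t) (deriv (γ x) t))) t := by
  have hcx : Differentiable ℝ fun y => γ y t :=
    (hγ.comp (contDiff_id.prodMk contDiff_const)).differentiable (by simp)
  have hct : Differentiable ℝ (γ x) :=
    (hγ.comp (contDiff_const.prodMk contDiff_id)).differentiable (by simp)
  have hH : meanCurv G (fun y => γ y t) = fun y => deriv (γ y) t :=
    funext fun y => (hflow y).symm
  have hslice := minner_deriv_meanCurv_unitT (c := fun y => γ y t) hsymm hG hd hcx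
    (hγ.differentiable_deriv_left t) hreg (y := x)
    (by rw [hH]; exact hγ.differentiable_deriv_right t x)
  rw [hH] at hslice
  have hv := hγ.hasDerivAt_deriv_swap x t
  have hN := mnorm_pos (hG (γ x t)) (hreg x)
  have h := (hasDerivAt_minner hsymm (hG _) (fun i j => hd i j _) (hct t).hasDerivAt hv hv).sqrt
    (minner_self_pos (hG (γ x t)) (hreg x)).ne'
  refine h.congr_deriv ?_
  rw [minner_comm (hsymm _) (deriv (fun y => γ y t) x), christoffelForm_comm hsymm]
  have hinner : minner (G (γ x t)) (deriv (fun y => deriv (γ y) t) x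
      + christoffelForm G (γ x t) (deriv (fun y => γ y t) x) (deriv (γ x) t))
        (deriv (fun y => γ y t) x)
      = -(mnorm (G (γ x t)) (deriv (fun y => γ y t) x) ^ 2
        * minner (G (γ x t)) (deriv (γ x) t) (deriv (γ x) t)) := by
    conv_lhs => arg 3; rw [deriv_eq_smul_unitT (c := fun y => γ y t) (hG _) (hreg x)]
    rw [minner_smul_right, hslice]
    ring
  rw [hinner]
  change _ / (2 * mnorm (G (γ x t)) (deriv (fun y => γ y t) x)) = _
  field_simp
  ring

end Flow
end Metric

section WarpedProduct

variable {n : ℕ} {g : (Fin n → ℝ) → Matrix (Fin n) (Fin n) ℝ} {φ : ℝ → ℝ}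

theorem gwR_symm (hgpd : ∀ x, (g x).PosDef) (p : Fin (n + 1) → ℝ) (i j : Fin (n + 1)) :
    gwR g φ p i j = gwR g φ p j i := by
  have h : ∀ i j, g (fun k => p k.succ) i j = g (fun k => p k.succ) j i := fun i j => by
    simpa using ((hgpd fun k => p k.succ).isHermitian.apply i j).symm
  refine Fin.cases ?_ (fun i => ?_) i <;> refine Fin.cases ?_ (fun j => ?_) j <;>
    simp only [gwR, Matrix.of_apply, Fin.cases_zero, Fin.cases_succ]
  rw [h]

theorem minner_gwR (p u v : Fin (n + 1) → ℝ) :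
    minner (gwR g φ p) u v = u 0 * v 0 + φ (p 0) ^ 2 *
      minner (g fun k => p k.succ) (fun i => u i.succ) (fun i => v i.succ) := by
  simp only [minner, gwR, Fin.sum_univ_succ, Matrix.of_apply, Fin.cases_zero, Fin.cases_succ,
    Finset.mul_sum]
  simp only [mul_one, mul_zero, zero_mul, Finset.sum_const_zero, add_zero, zero_add]
  congr 1
  refine Finset.sum_congr rfl fun i _ => Finset.sum_congr rfl fun j _ => by ring

theorem gwR_posDef (hgpd : ∀ x, (g x).PosDef) (hφpos : ∀ r, 0 < φ r) (p : Fin (n + 1) → ℝ) :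
    (gwR g φ p).PosDef := by
  refine Matrix.PosDef.of_dotProduct_mulVec_pos ?_ fun v hv => ?_
  · ext i j
    simpa using gwR_symm hgpd p j i
  · rw [star_trivial, ← minner_eq_dotProduct, minner_gwR]
    have hφ2 : 0 < φ (p 0) ^ 2 := pow_pos (hφpos _) 2
    by_cases h0 : v 0 = 0
    · have hne : (fun i : Fin n => v i.succ) ≠ 0 := by
        intro h
        exact hv (funext fun i => Fin.cases h0 (fun j => congrFun h j) i)
      have := mul_pos hφ2 (minner_self_pos (hgpd fun k => p k.succ) hne)
      simpa [h0] using this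
    · have := mul_nonneg hφ2.le (minner_self_nonneg (hgpd fun k => p k.succ) fun i => v i.succ)
      have := mul_self_pos.2 h0
      linarith

theorem differentiable_gwR (hg : ∀ i j, ContDiff ℝ (⊤ : ℕ∞) fun x => g x i j)
    (hφ : Differentiable ℝ φ) (i j : Fin (n + 1)) :
    Differentiable ℝ fun q => gwR g φ q i j := by
  have hg' : ∀ i j, Differentiable ℝ fun x => g x i j := fun i j =>
    (hg i j).differentiable (by simp)
  refine Fin.cases ?_ (fun i => ?_) i <;> refine Fin.cases ?_ (fun j => ?_) j <;>
    simp only [gwR, Matrix.of_apply, Fin.cases_zero, Fin.cases_succ, differentiable_const]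
  have h1 : Differentiable ℝ fun q : Fin (n + 1) → ℝ => g (fun k => q k.succ) i j :=
    (hg' i j).comp (by fun_prop)
  have h2 : Differentiable ℝ fun q : Fin (n + 1) → ℝ => φ (q 0) := hφ.comp (by fun_prop)
  exact (h2.pow 2).mul h1

theorem fderiv_gwR_single_zero (hg : ∀ i j, ContDiff ℝ (⊤ : ℕ∞) fun x => g x i j)
    (hφ : Differentiable ℝ φ) (p : Fin (n + 1) → ℝ) (i j : Fin n) :
    fderiv ℝ (fun q => gwR g φ q i.succ j.succ) p (Pi.single 0 1)
      = 2 * φ (p 0) * deriv φ (p 0) * g (fun k => p k.succ) i j := by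
  have hd := (differentiable_gwR hg hφ i.succ j.succ p).hasFDerivAt
  have hl : HasDerivAt (fun s : ℝ => p + s • (Pi.single 0 1 : Fin (n + 1) → ℝ))
      (Pi.single 0 1) 0 := by
    simpa using ((hasDerivAt_id (0 : ℝ)).smul_const (Pi.single 0 1 : Fin (n + 1) → ℝ)).const_add p
  have h1 := HasFDerivAt.comp_hasDerivAt (0 : ℝ) (by simpa using hd) hl
  have h2 : HasDerivAt (fun s : ℝ => φ (p 0 + s) ^ 2 * g (fun k => p k.succ) i j)
      (2 * φ (p 0) * deriv φ (p 0) * g (fun k => p k.succ) i j) 0 := by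
    have h3 : HasDerivAt (fun s : ℝ => φ (p 0 + s)) (deriv φ (p 0)) 0 :=
      HasDerivAt.comp_const_add (p 0) 0 (by simpa using (hφ (p 0)).hasDerivAt)
    simpa using (h3.pow 2).mul_const (g (fun k => p k.succ) i j)
  refine h1.unique (h2.congr_of_eventuallyEq (Filter.Eventually.of_forall fun s => ?_))
  simp [gwR]

theorem gwR_inv_zero (hgpd : ∀ x, (g x).PosDef) (hφpos : ∀ r, 0 < φ r) (p : Fin (n + 1) → ℝ)
    (δ : Fin (n + 1)) : (gwR g φ p)⁻¹ 0 δ = if 0 = δ then 1 else 0 := by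
  have hinv : gwR g φ p * (gwR g φ p)⁻¹ = 1 := Matrix.mul_nonsing_inv _
    ((Matrix.isUnit_iff_isUnit_det _).1 (gwR_posDef hgpd hφpos p).isUnit)
  rw [← Matrix.one_apply, ← hinv, Matrix.mul_apply, Fin.sum_univ_succ]
  simp [gwR]

theorem christoffelForm_gwR_zero (hg : ∀ i j, ContDiff ℝ (⊤ : ℕ∞) fun x => g x i j)
    (hgpd : ∀ x, (g x).PosDef) (hφ : Differentiable ℝ φ) (hφpos : ∀ r, 0 < φ r)
    (p u v : Fin (n + 1) → ℝ) :
    christoffelForm (gwR g φ) p u v 0 =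
      -(deriv φ (p 0) / φ (p 0) * (minner (gwR g φ p) u v - u 0 * v 0)) := by
  have hrow : ∀ β, (fun q => gwR g φ q 0 β) = fun _ => gwR g φ p 0 β := fun β => by
    funext q
    refine Fin.cases ?_ (fun j => ?_) β <;> simp [gwR]
  have hcol : ∀ β, (fun q => gwR g φ q β 0) = fun _ => gwR g φ p β 0 := fun β => by
    funext q
    refine Fin.cases ?_ (fun j => ?_) β <;> simp [gwR]
  have hΓ : ∀ β δ, christoffel (gwR g φ) p 0 β δ
      = -(1 / 2) * fderiv ℝ (fun q => gwR g φ q β δ) p (Pi.single 0 1) := by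
    intro β δ
    unfold christoffel
    rw [Finset.sum_eq_single 0]
    · simp [gwR_inv_zero hgpd hφpos, hrow]
    · intro μ _ hμ
      simp [gwR_inv_zero hgpd hφpos, hμ.symm]
    · simp
  have hφ0 := (hφpos (p 0)).ne'
  rw [minner_gwR]
  simp only [christoffelForm, hΓ, Fin.sum_univ_succ, hrow, hcol, fderiv_gwR_single_zero hg hφ]
  simp only [minner, Finset.mul_sum, add_sub_cancel_left, ← Finset.sum_neg_distrib]
  simp only [fderiv_fun_const, Pi.zero_apply, zero_apply, mul_zero, zero_mul,
    Finset.sum_const_zero, zero_add]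
  refine Finset.sum_congr rfl fun i _ => Finset.sum_congr rfl fun j _ => ?_
  field_simp

theorem thetaR_eq (γ : ℝ → ℝ → Fin (n + 1) → ℝ) (x t : ℝ) :
    thetaR g φ γ x t = unitT (gwR g φ) (fun y => γ y t) x 0 := by
  rw [thetaR, minner_gwR]
  simp [er, minner]

end WarpedProduct

/-- If `0 ≤ Θ_R ≤ 1` at a point, then
`∂_t Θ_R ≥ ΔΘ_R − |(log φ)''(γ⁰)|Θ_R + 2(log φ)'(γ⁰)Θ_R T(Θ_R)`. -/
theorem stmt12 {n : ℕ} (hn : 1 ≤ n)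
    (g : (Fin n → ℝ) → Matrix (Fin n) (Fin n) ℝ)
    (hg : ∀ i j, ContDiff ℝ (⊤ : ℕ∞) fun x => g x i j)
    (hgpd : ∀ x, (g x).PosDef)
    (φ : ℝ → ℝ) (hφ : ContDiff ℝ (⊤ : ℕ∞) φ) (hφpos : ∀ r, 0 < φ r)
    (t₀ : ℝ) (γ : ℝ → ℝ → Fin (n + 1) → ℝ)
    (hγ : ContDiff ℝ (⊤ : ℕ∞) fun q : ℝ × ℝ => γ q.1 q.2)
    (hreg : ∀ x t, deriv (fun y => γ y t) x ≠ 0)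
    (hflow : ∀ x : ℝ, ∀ t ∈ Set.Ico (0 : ℝ) t₀,
      deriv (γ x) t = meanCurv (gwR g φ) (fun y => γ y t) x)
    (x : ℝ) (t : ℝ) (ht : t ∈ Set.Ico (0 : ℝ) t₀)
    (hΘ0 : 0 ≤ thetaR g φ γ x t) (hΘ1 : thetaR g φ γ x t ≤ 1) :
    deriv (fun s => thetaR g φ γ x s) t
      ≥ lapScal (gwR g φ) (fun y => γ y t) (fun y => thetaR g φ γ y t) x
        - |deriv (deriv fun s => Real.log (φ s)) (γ x t 0)| * thetaR g φ γ x t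
        + 2 * deriv (fun s => Real.log (φ s)) (γ x t 0) * thetaR g φ γ x t
            * Tscal (gwR g φ) (fun y => γ y t) (fun y => thetaR g φ γ y t) x := by
  have hφd : Differentiable ℝ φ := hφ.differentiable (by simp)
  have hsymm := gwR_symm (φ := φ) hgpd
  have hG := gwR_posDef hgpd hφpos
  have hd := differentiable_gwR hg hφd
  obtain ⟨c, hc_eq⟩ : ∃ c : ℝ → Fin (n + 1) → ℝ, c = fun y => γ y t := ⟨_, rfl⟩
  have hcx : ∀ y, γ y t = c y := fun y => by rw [hc_eq]
  have hc : Differentiable ℝ c := by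
    rw [hc_eq]
    exact (hγ.comp (contDiff_id.prodMk contDiff_const)).differentiable (by simp)
  have hc' : Differentiable ℝ (deriv c) := by
    rw [hc_eq]
    exact hγ.differentiable_deriv_left t
  have hcreg : ∀ y, deriv c y ≠ 0 := fun y => by
    rw [hc_eq]
    exact hreg y t
  have hH : (fun y => deriv (γ y) t) = meanCurv (gwR g φ) c := funext fun y => by
    rw [hflow y t ht, hc_eq]
  have hHd : Differentiable ℝ (meanCurv (gwR g φ) c) := by
    rw [← hH]
    exact hγ.differentiable_deriv_right t
  have hT : Differentiable ℝ (unitT (gwR g φ) c) := fun y =>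
    differentiableAt_unitT hsymm (hG _) (fun i j => hd i j _) (hc y) (hc' y) (hcreg y)
  have hT0 : Differentiable ℝ fun y => unitT (gwR g φ) c y 0 := fun y =>
    differentiableAt_pi.1 (hT y) 0
  have hN : ∀ y, 0 < mnorm (gwR g φ (c y)) (deriv c y) := fun y => mnorm_pos (hG _) (hcreg y)
  have hθ : (fun y => thetaR g φ γ y t) = fun y => unitT (gwR g φ) c y 0 := funext fun y => by
    rw [thetaR_eq, hc_eq]
  have hlog : (deriv fun s => Real.log (φ s)) = fun r => deriv φ r / φ r := funext fun r =>
    ((hφd r).hasDerivAt.log (hφpos r).ne').deriv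
  have hlogd : Differentiable ℝ (deriv fun s => Real.log (φ s)) := by
    rw [hlog]
    have : Differentiable ℝ (deriv φ) :=
      (contDiff_infty_iff_deriv.1 hφ).2.differentiable (by simp)
    exact this.div hφd fun r => (hφpos r).ne'
  -- The tangential derivative of the angle function along the time slice.
  have hTθ : Tscal (gwR g φ) c (fun y => unitT (gwR g φ) c y 0) = fun y =>
      meanCurv (gwR g φ) c y 0 + deriv (fun s => Real.log (φ s)) (c y 0)
        * (1 - unitT (gwR g φ) c y 0 ^ 2) := by
    funext y
    have h := congrFun (smul_covT (hG (c y)) (hcreg y) (hT y)) 0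
    rw [Pi.add_apply, christoffelForm_gwR_zero hg hgpd hφd hφpos] at h
    have h1 : deriv (unitT (gwR g φ) c) y 0 = deriv (fun y => unitT (gwR g φ) c y 0) y :=
      (hasDerivAt_pi.1 (hT y).hasDerivAt 0).deriv.symm
    have h2 := congrFun (deriv_eq_smul_unitT (hG (c y)) (hcreg y)) 0
    have h3 : minner (gwR g φ (c y)) (deriv c y) (unitT (gwR g φ) c y)
        = mnorm (gwR g φ (c y)) (deriv c y) := by
      conv_lhs => arg 2; rw [deriv_eq_smul_unitT (hG (c y)) (hcreg y)]
      rw [minner_smul_left, minner_unitT_self (hG _) (hcreg y), mul_one]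
    simp only [Pi.smul_apply, smul_eq_mul] at h h2
    rw [h1, h3, h2] at h
    rw [hlog, Tscal, meanCurv, inv_mul_eq_iff_eq_mul₀ (hN y).ne', mul_add, h]
    ring
  have hlap : lapScal (gwR g φ) c (fun y => unitT (gwR g φ) c y 0) x =
      (mnorm (gwR g φ (c x)) (deriv c x))⁻¹ * deriv (meanCurv (gwR g φ) c) x 0
      + deriv (deriv fun s => Real.log (φ s)) (c x 0) * unitT (gwR g φ) c x 0
        * (1 - unitT (gwR g φ) c x 0 ^ 2)
      - 2 * deriv (fun s => Real.log (φ s)) (c x 0) * unitT (gwR g φ) c x 0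
        * Tscal (gwR g φ) c (fun y => unitT (gwR g φ) c y 0) x := by
    have h1 := hasDerivAt_pi.1 (hHd x).hasDerivAt 0
    have h2 : HasDerivAt (fun y => deriv (fun s => Real.log (φ s)) (c y 0))
        (deriv (deriv fun s => Real.log (φ s)) (c x 0) * deriv c x 0) x :=
      HasDerivAt.comp (h₂ := deriv fun s => Real.log (φ s)) (h := fun y => c y 0) x
        (hlogd (c x 0)).hasDerivAt (hasDerivAt_pi.1 (hc x).hasDerivAt 0)
    have h3 := h1.add (h2.mul (((hT0 x).hasDerivAt.pow 2).const_sub 1))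
    have h4 := (h3.congr_of_eventuallyEq (Filter.Eventually.of_forall (congrFun hTθ))).deriv
    have h5 : unitT (gwR g φ) c x 0
      = (mnorm (gwR g φ (c x)) (deriv c x))⁻¹ * deriv c x 0 := rfl
    rw [lapScal]
    unfold Tscal at h4 ⊢
    rw [h4]
    simp only [Pi.pow_apply]
    linear_combination (-(deriv (deriv fun s => Real.log (φ s)) (c x 0))
      * (1 - unitT (gwR g φ) c x 0 ^ 2)) * h5
  have htime : deriv (fun s => thetaR g φ γ x s) t =
      (mnorm (gwR g φ (c x)) (deriv c x))⁻¹ * deriv (meanCurv (gwR g φ) c) x 0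
      + minner (gwR g φ (c x)) (meanCurv (gwR g φ) c x) (meanCurv (gwR g φ) c x)
        * unitT (gwR g φ) c x 0 := by
    have h1 := hasDerivAt_mnorm_of_flow hsymm hG hd hγ (fun y => hreg y t)
      (fun y => hflow y t ht) x
    have h2 := hasDerivAt_pi.1 (hγ.hasDerivAt_deriv_swap x t) 0
    have h3 := (h1.inv (mnorm_pos (hG _) (hreg x t)).ne').mul h2
    have h4 : (fun s => thetaR g φ γ x s) = fun s =>
        (mnorm (gwR g φ (γ x s)) (deriv (fun y => γ y s) x))⁻¹ * deriv (fun y => γ y s) x 0 :=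
      funext fun s => thetaR_eq γ x s
    rw [h4]
    refine h3.deriv.trans ?_
    have h5 : unitT (gwR g φ) c x 0
      = (mnorm (gwR g φ (c x)) (deriv c x))⁻¹ * deriv c x 0 := rfl
    have hHx : deriv (γ x) t = meanCurv (gwR g φ) c x := congrFun hH x
    have hN' := (hN x).ne'
    simp only [Pi.inv_apply, hHx, hH, hcx, h5]
    field_simp
    ring
  have hθx : thetaR g φ γ x t = unitT (gwR g φ) c x 0 := congrFun hθ x
  rw [htime, hθ, hθx, ← hc_eq, hcx, hlap]
  rw [hθx] at hΘ0 hΘ1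
  have hHH := mul_nonneg (minner_self_nonneg (hG (c x)) (meanCurv (gwR g φ) c x)) hΘ0
  have habs : deriv (deriv fun s => Real.log (φ s)) (c x 0) * unitT (gwR g φ) c x 0
      * (1 - unitT (gwR g φ) c x 0 ^ 2)
      ≤ |deriv (deriv fun s => Real.log (φ s)) (c x 0)| * unitT (gwR g φ) c x 0 := by
    set a := deriv (deriv fun s => Real.log (φ s)) (c x 0)
    have h1 : a * (1 - unitT (gwR g φ) c x 0 ^ 2) ≤ |a| := by
      have hsq : unitT (gwR g φ) c x 0 ^ 2 ≤ 1 := pow_le_one₀ hΘ0 hΘ1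
      calc a * (1 - unitT (gwR g φ) c x 0 ^ 2)
          ≤ |a| * (1 - unitT (gwR g φ) c x 0 ^ 2) :=
            mul_le_mul_of_nonneg_right (le_abs_self a) (by linarith)
        _ ≤ |a| := mul_le_of_le_one_right (abs_nonneg a)
            (by linarith [sq_nonneg (unitT (gwR g φ) c x 0)])
    calc _ = a * (1 - unitT (gwR g φ) c x 0 ^ 2) * unitT (gwR g φ) c x 0 := by ring
      _ ≤ _ := mul_le_mul_of_nonneg_right h1 hΘ0
  linarith

end
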